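/- arXiv:1812.04565 — 4 statements merged into one kernel-verified Lean document; each statement's English description precedes it below -/
import Mathlib

section
/- Let m ∈ ℕ and let R denote the ring of formal Laurent series over ℤ (e.g. LaurentSeries ℤ). Suppose p(τ,y) = Σ_{a≥0} Σ_{b=−m}^{m} α_{a,b} τ^a y^b is a formal power series in τ whose τ^a-coefficient is a Laurent polynomial in y of degree at most m with coefficients α_{a,b} ∈ R, satisfying: (1) α_{a,b} = α_{a,−b} for all a,b; (2) α_{a,b} = 0 whenever a < |b|; (3) the specialisation p(τ,τ) is a constant nonnegative integer, i.e. Σ_{b=−m}^{m} α_{c−b,b} = 0 for every c ≥ 1 (with α_{a,b} := 0 for a < 0) and Σ_{b=−m}^{0} α_{−b,b} is a nonnegative integer multiple of 1 ∈ R; (4) for each 0 ≤ a ≤ m, α_{a,−a} is a nonnegative integer multiple of 1 ∈ R. Then there exist nonnegative integers N_a (0 ≤ a ≤ m) and elements Ñ_{a,b} ∈ R (for integers a > b ≥ 0 with b ≤ m−1) such that, as an identity of coefficients of τ^a y^b, p(τ,y) = Σ_{a=0}^{m} N_a · I_{a,a}(τ,y) + Σ_{a>b≥0} Ñ_{a,b}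 · I_{a,b}(τ,y) (the second sum is locally finite in powers of τ since I_{a,b} involves only τ^a, τ^{a+1}, τ^{a+2}). -/
open Finset

/-- Coefficient of `y^d` in the `su(2)` character `χ_n(y) = Σ_{k=0}^n y^{n-2k}`,
extended by `χ_n = 0` for `n < 0`. -/
def chiCoeff (n : ℤ) (d : ℤ) : ℤ :=
  if 0 ≤ n ∧ |d| ≤ n ∧ (n - d) % 2 = 0 then 1 else 0

/-- Coefficient of `τ^c y^d` in the 1/2-BPS character
`I_{m,m}(τ,y) = τ^m (χ_m(y) - τ χ_{m-1}(y))`. -/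
def IhalfCoeff (m : ℕ) (co : ℕ) (d : ℤ) : ℤ :=
  (if co = m then chiCoeff m d else 0) - (if co = m + 1 then chiCoeff ((m : ℤ) - 1) d else 0)

/-- Coefficient of `τ^c y^d` in the short character
`I_{m,n}(τ,y) = τ^m ((1+τ²) χ_n(y) - τ (χ_{n+1}(y) + χ_{n-1}(y)))`, for `m > n ≥ 0`. -/
def IshortCoeff (m n : ℕ) (co : ℕ) (d : ℤ) : ℤ :=
  (if co = m ∨ co = m + 2 then chiCoeff n d else 0) -
    (if co = m + 1 then chiCoeff ((n : ℤ) + 1) d + chiCoeff ((n : ℤ) - 1) d else 0)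

theorem chiCoeff_neg (n d : ℤ) : chiCoeff n (-d) = chiCoeff n d := by
  unfold chiCoeff
  rw [abs_neg]
  congr 1
  have : (n - -d) % 2 = 0 ↔ (n - d) % 2 = 0 := by omega
  rw [this]

/-- Clebsch–Gordan: `χ_{n+1} + χ_{n-1} = χ_1 χ_n`. -/
theorem chiCoeff_succ_add_pred (n : ℕ) (d : ℤ) :
    chiCoeff ((n : ℤ) + 1) d + chiCoeff ((n : ℤ) - 1) d
      = chiCoeff n (d + 1) + chiCoeff n (d - 1) := by
  unfold chiCoeff
  simp only [abs_le]
  split_ifs <;> omega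

theorem IhalfCoeff_neg (n a : ℕ) (d : ℤ) : IhalfCoeff n a (-d) = IhalfCoeff n a d := by
  unfold IhalfCoeff
  rw [chiCoeff_neg, chiCoeff_neg]

theorem IhalfCoeff_eq_zero_of_lt_abs {n a : ℕ} {d : ℤ} (h : (n : ℤ) < |d|) :
    IhalfCoeff n a d = 0 := by
  unfold IhalfCoeff chiCoeff
  split_ifs <;> omega

theorem IhalfCoeff_of_le_abs {n a : ℕ} {d : ℤ} (h : (a : ℤ) ≤ |d|) :
    IhalfCoeff n a d = if n = a ∧ |d| = a then 1 else 0 := by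
  unfold IhalfCoeff chiCoeff
  rcases abs_cases d with ⟨h1, h2⟩ | ⟨h1, h2⟩ <;> rw [h1] at h ⊢ <;> split_ifs <;> omega

/-- The specialisation `I_{n,n}(τ, τ⁻¹) = 1`, read off along the line `a - d = c`. -/
theorem sum_IhalfCoeff_line {n a : ℕ} {c : ℤ} (h : c + n ≤ a) :
    ∑ i ∈ range (a + 1), IhalfCoeff n i (i - c) = if c = 0 then 1 else 0 := by
  have key : ∀ i : ℕ, IhalfCoeff n i (i - c) =
      (if n = i then chiCoeff n (n - c) else 0)
        - (if n + 1 = i then chiCoeff ((n : ℤ) - 1) (n + 1 - c) else 0) := by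
    intro i
    unfold IhalfCoeff
    congr 1
    · split_ifs <;> grind
    · split_ifs <;> grind
  simp only [key, sum_sub_distrib, sum_ite_eq, mem_range]
  unfold chiCoeff
  simp only [abs_le]
  split_ifs <;> omega

section CommRing

variable {R : Type*} [CommRing R]

theorem sum_range_sub_mul_chiCoeff_of_nonneg (f : ℤ → R) (d M : ℕ) (h : d ≤ M) :
    ∑ n ∈ range M, (f n - f (n + 2)) * ((chiCoeff n d : ℤ) : R)
      = f d - (if ((M : ℤ) - d) % 2 = 0 then f M else f (M + 1)) := by
  induction M, h using Nat.le_induction with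
  | base =>
    simp only [sub_self, EuclideanDomain.zero_mod, if_true]
    refine sum_eq_zero fun n hn => ?_
    have hn := mem_range.1 hn
    have : chiCoeff n d = 0 := by
      unfold chiCoeff
      rw [if_neg]
      rw [abs_of_nonneg (by omega)]
      omega
    simp [this]
  | succ M hM ih =>
    rw [sum_range_succ, ih]
    by_cases hp : ((M : ℤ) - d) % 2 = 0
    · have hc : chiCoeff M d = 1 := by
        unfold chiCoeff
        rw [if_pos]
        rw [abs_of_nonneg (by omega)]
        omega
      rw [if_pos hp, if_neg (by push_cast; omega), hc]
      push_cast
      rw [show (M : ℤ) + 1 + 1 = M + 2 by ring]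
      ring
    · have hc : chiCoeff M d = 0 := by
        unfold chiCoeff
        rw [if_neg]
        omega
      rw [if_neg hp, if_pos (by push_cast; omega), hc]
      push_cast
      ring

/-- A symmetric Laurent polynomial of degree less than `M` is a combination of
the characters `χ_n`, `n < M`. -/
theorem sum_range_sub_mul_chiCoeff (f : ℤ → R) (M : ℕ) (hf : ∀ d, f (-d) = f d)
    (hM : ∀ d : ℤ, (M : ℤ) ≤ d → f d = 0) (d : ℤ) :
    ∑ n ∈ range M, (f n - f (n + 2)) * ((chiCoeff n d : ℤ) : R) = f d := by
  have main : ∀ e : ℕ, ∑ n ∈ range M, (f n - f (n + 2)) * ((chiCoeff n e : ℤ) : R) = f e := by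
    intro e
    rcases le_total e M with he | he
    · rw [sum_range_sub_mul_chiCoeff_of_nonneg f e M he, hM M le_rfl, hM (M + 1) (by omega)]
      simp
    · rw [hM e (by exact_mod_cast he)]
      refine sum_eq_zero fun n hn => ?_
      have hn := mem_range.1 hn
      have : chiCoeff n e = 0 := by
        unfold chiCoeff
        rw [if_neg]
        rw [abs_of_nonneg (by omega)]
        omega
      simp [this]
  obtain ⟨e, rfl | rfl⟩ := d.eq_nat_or_neg
  · exact main e
  · simp only [chiCoeff_neg, hf]
    exact main e

/-- The coefficients of `q(τ,y) / ((1 - τ y) (1 - τ y⁻¹))`. -/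
def divCoeff (q : ℕ → ℤ → R) : ℕ → ℤ → R
  | 0, b => q 0 b
  | 1, b => q 1 b + divCoeff q 0 (b + 1) + divCoeff q 0 (b - 1)
  | n + 2, b => q (n + 2) b + divCoeff q (n + 1) (b + 1) + divCoeff q (n + 1) (b - 1)
      - divCoeff q n b

theorem divCoeff_neg {q : ℕ → ℤ → R} (hq : ∀ a b, q a (-b) = q a b) (a : ℕ) (b : ℤ) :
    divCoeff q a (-b) = divCoeff q a b := by
  induction a using Nat.strong_induction_on generalizing b with
  | _ a ih =>
    have hs : ∀ n < a, divCoeff q n (-b + 1) = divCoeff q n (b - 1) ∧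
        divCoeff q n (-b - 1) = divCoeff q n (b + 1) := fun n hn => by
      rw [← ih n hn (b - 1), ← ih n hn (b + 1)]
      constructor <;> congr 1 <;> ring
    match a with
    | 0 => simp [divCoeff, hq]
    | 1 =>
      have h := hs 0 (by omega)
      simp only [divCoeff] at h ⊢
      rw [hq, h.1, h.2]
      ring
    | n + 2 =>
      rw [divCoeff, divCoeff, hq, (hs (n + 1) (by omega)).1, (hs (n + 1) (by omega)).2,
        ih n (by omega)]
      ring

theorem divCoeff_eq_zero_of_le {q : ℕ → ℤ → R} (hq : ∀ (a : ℕ) (b : ℤ), (a : ℤ) ≤ b → q a b = 0)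
    (a : ℕ) (b : ℤ) (hb : (a : ℤ) ≤ b) : divCoeff q a b = 0 := by
  induction a using Nat.strong_induction_on generalizing b with
  | _ a ih =>
    match a with
    | 0 => simpa [divCoeff] using hq 0 b hb
    | 1 =>
      rw [divCoeff, hq 1 b hb, ih 0 (by omega) _ (by omega), ih 0 (by omega) _ (by omega)]
      ring
    | n + 2 =>
      rw [divCoeff, hq (n + 2) b hb, ih (n + 1) (by omega) _ (by omega),
        ih (n + 1) (by omega) _ (by omega), ih n (by omega) _ (by omega)]
      ring

/-- Multiplying the quotient back by `1 - τ y⁻¹` gives `q(τ,y) / (1 - τ y)`, a sum along a line. -/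
theorem divCoeff_succ_sub (q : ℕ → ℤ → R) (a : ℕ) (b : ℤ) :
    divCoeff q (a + 1) b - divCoeff q a (b + 1) =
      ∑ i ∈ range (a + 2), q i (i - ((a + 1 : ℕ) - b)) := by
  induction a generalizing b with
  | zero =>
    simp only [sum_range_succ, range_zero, sum_empty, divCoeff]
    push_cast
    rw [zero_add, zero_sub, neg_sub, sub_sub_cancel]
    ring
  | succ n ih =>
    have h := ih (b - 1)
    rw [sub_add_cancel] at h
    rw [sum_range_succ, divCoeff]
    have e : ∑ i ∈ range (n + 2), q i (i - ((n + 1 + 1 : ℕ) - b)) =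
        ∑ i ∈ range (n + 2), q i (i - ((n + 1 : ℕ) - (b - 1))) := by
      refine sum_congr rfl fun i _ => ?_
      congr 1
      push_cast
      ring
    rw [e, ← h, show ((n + 1 + 1 : ℕ) : ℤ) - ((n + 1 + 1 : ℕ) - b) = b by ring]
    ring

theorem divCoeff_eq_zero_of_line_sum {q : ℕ → ℤ → R} {m : ℤ}
    (hq : ∀ (a : ℕ) (b : ℤ), m ≤ b → ∑ i ∈ range (a + 1), q i (i - (a - b)) = 0)
    (a : ℕ) (b : ℤ) (hb : m ≤ b) : divCoeff q a b = 0 := by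
  induction a generalizing b with
  | zero => simpa [divCoeff] using hq 0 b hb
  | succ n ih =>
    have h := divCoeff_succ_sub q n b
    rw [hq (n + 1) b hb, ih (b + 1) (by omega), sub_zero] at h
    exact h

/-- A symmetric `q` of degree at most `m` in `y`, vanishing at `y = τ^{±1}`, is a combination of
the short characters `I_{a,b}`, `b < m`. -/
theorem eq_sum_IshortCoeff {m : ℕ} {q : ℕ → ℤ → R} (hneg : ∀ a b, q a (-b) = q a b)
    (hdiag : ∀ (a : ℕ) (b : ℤ), (a : ℤ) ≤ b → q a b = 0)
    (hline : ∀ (a : ℕ) (b : ℤ), (m : ℤ) ≤ b → ∑ i ∈ range (a + 1), q i (i - (a - b)) = 0)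
    (a : ℕ) (b : ℤ) :
    q a b = ∑ a' ∈ range (a + 1), ∑ b' ∈ range (min a' m),
      (divCoeff q a' b' - divCoeff q a' (b' + 2)) * ((IshortCoeff a' b' a b : ℤ) : R) := by
  set s := divCoeff q with hs
  have hexp : ∀ (n : ℕ) (d : ℤ), ∑ k ∈ range (min n m),
      (s n k - s n (k + 2)) * ((chiCoeff k d : ℤ) : R) = s n d := by
    intro n d
    refine sum_range_sub_mul_chiCoeff (s n) _ (divCoeff_neg hneg n) (fun d hd => ?_) d
    rcases le_total n m with h | h
    · exact divCoeff_eq_zero_of_le hdiag n d (by rw [min_eq_left h] at hd; exact hd)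
    · exact divCoeff_eq_zero_of_line_sum hline n d (by rw [min_eq_right h] at hd; exact hd)
  have hshort : ∀ n : ℕ, ∑ k ∈ range (min n m),
      (s n k - s n (k + 2)) * ((IshortCoeff n k a b : ℤ) : R) =
      (if a = n ∨ a = n + 2 then s n b else 0)
        - (if a = n + 1 then s n (b + 1) + s n (b - 1) else 0) := by
    intro n
    rw [← hexp n b, ← hexp n (b + 1), ← hexp n (b - 1), ← sum_add_distrib]
    unfold IshortCoeff
    simp only [chiCoeff_succ_add_pred]
    by_cases h : a = n + 1
    · simp [h, mul_add, sum_add_distrib, add_comm]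
    · by_cases h' : a = n ∨ a = n + 2 <;> simp [h, h']
  simp only [hshort]
  match a with
  | 0 => simp [hs, divCoeff]
  | 1 => simp [hs, divCoeff]
  | n + 2 =>
    rw [sum_range_succ, sum_range_succ, sum_range_succ, sum_eq_zero]
    · simp [hs, divCoeff]
      ring
    · intro i hi
      have := mem_range.1 hi
      rw [if_neg (by omega), if_neg (by omega), sub_zero]

theorem sum_line_eq_sum_Icc {m : ℕ} {α : ℕ → ℤ → R}
    (hsupp : ∀ (a : ℕ) (b : ℤ), (m : ℤ) < |b| → α a b = 0)
    (hneg : ∀ (a : ℕ) (b : ℤ), α a b = α a (-b)) (a : ℕ) (c : ℤ) (h : c + m ≤ a) :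
    ∑ i ∈ range (a + 1), α i (i - c) =
      ∑ b ∈ Icc (-(m : ℤ)) m, if 0 ≤ c - b then α (c - b).toNat b else 0 := by
  rw [← sum_filter]
  refine sum_bij_ne_zero (fun i _ _ => c - i) ?_ ?_ ?_ ?_
  · intro i _ hne
    have : |(i : ℤ) - c| ≤ m := not_lt.1 fun hlt => hne (hsupp _ _ hlt)
    rw [abs_le] at this
    simp only [mem_filter, mem_Icc]
    omega
  · intro i _ _ j _ _ hij
    omega
  · intro b hb hne
    simp only [mem_filter, mem_Icc] at hb
    have e : (((c - b).toNat : ℕ) : ℤ) = c - b := Int.toNat_of_nonneg hb.2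
    refine ⟨(c - b).toNat, by simp only [mem_range]; omega, ?_, by omega⟩
    rw [hneg, e]
    simpa using hne
  · intro i _ _
    rw [hneg]
    congr 1
    · omega
    · ring

/-- The character expansion over an arbitrary commutative ring. -/
theorem character_expansion_of_commRing {m : ℕ} {α : ℕ → ℤ → R}
    (hsupp : ∀ (a : ℕ) (b : ℤ), (m : ℤ) < |b| → α a b = 0)
    (hneg : ∀ (a : ℕ) (b : ℤ), α a b = α a (-b))
    (hdiag : ∀ (a : ℕ) (b : ℤ), (a : ℤ) < |b| → α a b = 0)
    (hline : ∀ c : ℤ, 1 ≤ c →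
      (∑ b ∈ Icc (-(m : ℤ)) (m : ℤ), if 0 ≤ c - b then α (c - b).toNat b else 0) = 0)
    {N : ℕ → ℕ} (hN : ∀ a : ℕ, a ≤ m → α a (-(a : ℤ)) = (N a : R)) :
    ∃ Nt : ℕ → ℕ → R, ∀ (a : ℕ) (b : ℤ),
      α a b = (∑ a' ∈ range (m + 1), (N a' : R) * ((IhalfCoeff a' a b : ℤ) : R)) +
        ∑ a' ∈ range (a + 1), ∑ b' ∈ range (min a' m),
          Nt a' b' * ((IshortCoeff a' b' a b : ℤ) : R) := by
  set q : ℕ → ℤ → R := fun a b =>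
    α a b - ∑ a' ∈ range (m + 1), (N a' : R) * ((IhalfCoeff a' a b : ℤ) : R) with hqdef
  refine ⟨fun a' b' => divCoeff q a' b' - divCoeff q a' (b' + 2), fun a b => ?_⟩
  rw [← sub_eq_iff_eq_add']
  have hαN : ∀ i : ℕ, i ≤ m → α i i = N i := fun i hi => by rw [hneg, hN i hi]
  refine eq_sum_IshortCoeff (q := q) (fun a b => ?_) (fun a b hab => ?_) (fun a b hb => ?_) a b
  · simp only [hqdef, IhalfCoeff_neg, ← hneg]
  · have hb : |b| = b := abs_of_nonneg (by omega)
    simp only [hqdef, IhalfCoeff_of_le_abs (hab.trans (le_abs_self b)), hb]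
    rcases hab.eq_or_lt with rfl | hlt
    · by_cases ham : a ≤ m
      · simp [hαN a ham, ham]
      · simp [hsupp a a (by rw [hb]; omega), ham]
    · rw [hdiag a b (hb.symm ▸ hlt)]
      simp [hlt.ne']
  · simp only [hqdef, sum_sub_distrib]
    rw [sum_comm]
    have hhalf : ∀ n ∈ range (m + 1), ∑ i ∈ range (a + 1),
        (N n : R) * ((IhalfCoeff n i (i - (a - b)) : ℤ) : R) =
          if (a : ℤ) - b = 0 then (N n : R) else 0 := by
      intro n hn
      have hn := mem_range.1 hn
      rw [← mul_sum, ← Int.cast_sum, sum_IhalfCoeff_line (by omega)]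
      split_ifs <;> simp
    rw [sum_congr rfl hhalf]
    rcases lt_trichotomy ((a : ℤ) - b) 0 with hc | hc | hc
    · simp only [hc.ne, if_false, sum_const_zero, sub_zero]
      refine sum_eq_zero fun i _ => hdiag _ _ ?_
      rw [abs_of_nonneg (by omega)]
      omega
    · simp only [hc, if_true, sub_zero]
      rw [sub_eq_zero, ← sum_subset (range_subset_range.2 (show m + 1 ≤ a + 1 by omega))]
      · exact sum_congr rfl fun i hi => hαN i (by have := mem_range.1 hi; omega)
      · intro i _ hi
        rw [mem_range] at hi
        exact hsupp _ _ (by rw [abs_of_nonneg (by omega)]; omega)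
    · simp only [hc.ne', if_false, sum_const_zero, sub_zero]
      rw [sum_line_eq_sum_Icc hsupp hneg a _ (by omega)]
      exact hline _ (by omega)

end CommRing

/-- Let `R = LaurentSeries ℤ` and let `p(τ,y) = Σ_{a≥0} Σ_{|b|≤m} α_{a,b} τ^a y^b`
satisfy: (1) `α_{a,b} = α_{a,-b}`; (2) `α_{a,b} = 0` for `a < |b|`; (3) `p(τ,τ)` is a
constant nonnegative integer; (4) each `α_{a,-a}` with `a ≤ m` is a nonnegative integer
multiple of `1 ∈ R`.  Then there are nonnegative integers `N_a` (`0 ≤ a ≤ m`) and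
elements `Ñ_{a,b} ∈ R` (`a > b ≥ 0`, `b ≤ m-1`) with
`p = Σ_{a=0}^m N_a I_{a,a} + Σ_{a>b} Ñ_{a,b} I_{a,b}`
as an identity of coefficients of `τ^a y^b` (the coefficient of `τ^a` receives
contributions only from `I_{a',b'}` with `a' ≤ a`, so the sums are finite). -/
theorem su12_character_expansion (m : ℕ) (α : ℕ → ℤ → LaurentSeries ℤ)
    (hsupp : ∀ (a : ℕ) (b : ℤ), (m : ℤ) < |b| → α a b = 0)
    (h1 : ∀ (a : ℕ) (b : ℤ), α a b = α a (-b))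
    (h2 : ∀ (a : ℕ) (b : ℤ), (a : ℤ) < |b| → α a b = 0)
    (h3a : ∀ c : ℤ, 1 ≤ c →
      (∑ b ∈ Finset.Icc (-(m : ℤ)) (m : ℤ),
        if 0 ≤ c - b then α (c - b).toNat b else 0) = 0)
    (h3b : ∃ n : ℕ, (∑ b ∈ Finset.Icc (-(m : ℤ)) 0, α (-b).toNat b) = (n : LaurentSeries ℤ))
    (h4 : ∀ a : ℕ, a ≤ m → ∃ n : ℕ, α a (-(a : ℤ)) = (n : LaurentSeries ℤ)) :
    ∃ (N : ℕ → ℕ) (Nt : ℕ → ℕ → LaurentSeries ℤ),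
      ∀ (a : ℕ) (b : ℤ),
        α a b =
          (∑ a' ∈ Finset.range (m + 1),
            (N a' : LaurentSeries ℤ) * ((IhalfCoeff a' a b : ℤ) : LaurentSeries ℤ)) +
          ∑ a' ∈ Finset.range (a + 1), ∑ b' ∈ Finset.range (min a' m),
            Nt a' b' * ((IshortCoeff a' b' a b : ℤ) : LaurentSeries ℤ) := by
  choose! N hN using h4
  obtain ⟨Nt, hNt⟩ := character_expansion_of_commRing hsupp h1 h2 h3a hN
  exact ⟨N, Nt, hNt⟩
end

section
/- Suppose c : ℕ → ℤ and d : {(a,b) ∈ ℕ×ℕ : a > b} → ℤ are such that the formal series Σ_{m≥0} c_m · I_{m,m}(τ,y) + Σ_{a>b≥0} d_{a,b} · I_{a,b}(τ,y) vanishes identically (this sum is a well-defined formal power series in τ with Laurent-polynomial coefficients in y, since I_{m,m} involves only τ^m, τ^{m+1} and I_{a,b} involves only τ^a, τ^{a+1}, τ^{a+2}, so each power of τ receives only finitely many contributions). Then c_m = 0 for all m ≥ 0 and d_{a,b} = 0 for all a > b ≥ 0. In particular the multiplicities of 1/2-BPS multiplets and the signed multiplicities of the remaining (semi-)short multiplets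 can be read off uniquely from the superconformal index. -/
open Finset

/-- For `k ≥ 0`, the multiplicity of the spin `k/2` representation in the spin `n/2` one is the
jump of weight multiplicities between the weights `k` and `k + 2`. -/
theorem chiCoeff_sub_chiCoeff_add_two (n k : ℕ) :
    chiCoeff n k - chiCoeff n ((k : ℤ) + 2) = if n = k then 1 else 0 := by
  have h₁ : |(k : ℤ)| = k := abs_of_nonneg (by omega)
  have h₂ : |(k : ℤ) + 2| = k + 2 := abs_of_nonneg (by omega)
  unfold chiCoeff
  rw [h₁, h₂]
  split_ifs <;> omega

/-- The characters `χ_n` are linearly independent. -/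
theorem eq_zero_of_sum_mul_chiCoeff_eq_zero (N : ℕ) (f : ℕ → ℤ)
    (h : ∀ b : ℤ, ∑ n ∈ Finset.range N, f n * chiCoeff n b = 0) {k : ℕ} (hk : k < N) :
    f k = 0 := by
  have h₁ : ∑ n ∈ Finset.range N, f n * (chiCoeff n k - chiCoeff n ((k : ℤ) + 2)) = 0 := by
    simp only [mul_sub, Finset.sum_sub_distrib, h, sub_zero]
  simpa [chiCoeff_sub_chiCoeff_add_two, hk] using h₁

theorem IhalfCoeff_self (m : ℕ) (b : ℤ) : IhalfCoeff m m b = chiCoeff m b := by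
  simp [IhalfCoeff]

theorem IshortCoeff_self (m n : ℕ) (b : ℤ) : IshortCoeff m n m b = chiCoeff n b := by
  simp [IshortCoeff]

/-- Linear independence of the `su(1|2)` index characters.  Suppose `c : ℕ → ℤ` and
`d : ℕ → ℕ → ℤ` are such that the formal series
`Σ_{m≥0} c_m I_{m,m}(τ,y) + Σ_{a>b≥0} d_{a,b} I_{a,b}(τ,y)` vanishes identically
(each coefficient of `τ^a y^b` receives only finitely many contributions, namely from
`I_{m,m}` with `m ≤ a` and `I_{a',b'}` with `a' ≤ a`).  Then `c_m = 0` for all `m` and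
`d_{a,b} = 0` for all `a > b ≥ 0`: the multiplicities of 1/2-BPS multiplets and the
signed multiplicities of the remaining (semi-)short multiplets are read off uniquely
from the superconformal index. -/
theorem su12_characters_linearly_independent (c : ℕ → ℤ) (d : ℕ → ℕ → ℤ)
    (h : ∀ (a : ℕ) (b : ℤ),
      (∑ m ∈ Finset.range (a + 1), c m * IhalfCoeff m a b) +
        (∑ a' ∈ Finset.range (a + 1), ∑ b' ∈ Finset.range a',
          d a' b' * IshortCoeff a' b' a b) = 0) :
    (∀ m : ℕ, c m = 0) ∧ (∀ a b : ℕ, b < a → d a b = 0) := by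
  suffices H : ∀ a : ℕ, c a = 0 ∧ ∀ b < a, d a b = 0 from
    ⟨fun m ↦ (H m).1, fun a b hb ↦ (H a).2 b hb⟩
  intro a
  induction a using Nat.strong_induction_on with
  | _ a ih =>
    have hχ : ∀ b : ℤ, ∑ n ∈ Finset.range (a + 1),
        (if n = a then c a else d a n) * chiCoeff n b = 0 := by
      intro b
      have hc : ∑ m ∈ Finset.range a, c m * IhalfCoeff m a b = 0 :=
        Finset.sum_eq_zero fun m hm ↦ by rw [(ih m (Finset.mem_range.1 hm)).1, zero_mul]
      have hd : ∑ m ∈ Finset.range a, ∑ n ∈ Finset.range m,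
          d m n * IshortCoeff m n a b = 0 :=
        Finset.sum_eq_zero fun m hm ↦ Finset.sum_eq_zero fun n hn ↦ by
          rw [(ih m (Finset.mem_range.1 hm)).2 n (Finset.mem_range.1 hn), zero_mul]
      have hlead := h a b
      simp only [Finset.sum_range_succ _ a, hc, hd, zero_add, IhalfCoeff_self,
        IshortCoeff_self] at hlead
      rw [Finset.sum_range_succ, if_pos rfl, add_comm, ← hlead]
      congr 1
      refine Finset.sum_congr rfl fun n hn ↦ ?_
      rw [if_neg (Finset.mem_range.1 hn).ne]
    have hf := fun {k : ℕ} (hk : k < a + 1) ↦ eq_zero_of_sum_mul_chiCoeff_eq_zero _ _ hχ hk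
    refine ⟨by simpa using hf a.lt_succ_self, fun b hb ↦ ?_⟩
    simpa [hb.ne] using hf (Nat.lt_succ_of_lt hb)
end

section
/- Let N ≥ 1, let (l_1, …, l_p) be a composition of N (positive integers with l_1 + ⋯ + l_p = N), and define the block function h : {1,…,N} → {1,…,p} by h(i) = j if and only if l_1 + ⋯ + l_{j−1} < i ≤ l_1 + ⋯ + l_j. Let q ∈ ℂ and let z_1, …, z_N ∈ ℂ be nonzero and pairwise distinct. Then (Σ_{w ∈ S_N} Π_{(i,j) : h(i) > h(j)} (1 − q·z_{w(i)}/z_{w(j)}) / (1 − z_{w(i)}/z_{w(j)})) · Π_{j=1}^{p} Π_{i=1}^{l_j} (1 − q^i) = (Π_{j=1}^{p} l_j!) · Π_{i=1}^{N} (1 − q^i). In particular, the sum on the left-hand side is independent of the choice of the z_i and equals the Poincaré polynomial of the cotangent bundle of the partial flag variety determined by the composition, times the order of the Weyl group W̃ = Π_j S_{l_j} of the Levi subgroup. -/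
open Finset

/-- The rational factor `(1 - q a / b) / (1 - a / b)`. -/
noncomputable def weylFactor (q a b : ℂ) : ℂ := (1 - q * a / b) / (1 - a / b)

/-- The product of the factors attached to all pairs `j < i`. -/
noncomputable def weylProd {ι : Type*} [Fintype ι] [LinearOrder ι] (q : ℂ) (z : ι → ℂ) : ℂ :=
  ∏ i, ∏ j, if j < i then weylFactor q (z i) (z j) else 1

lemma weylFactor_eq (q a : ℂ) {b : ℂ} (hb : b ≠ 0) :
    weylFactor q a b = (b - q * a) / (b - a) := by
  unfold weylFactor
  rw [← mul_div_mul_left _ _ hb]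
  congr 1 <;> field_simp

/-- Projective space case of the Weyl sum, obtained by Lagrange interpolation of
`∏ k, (X - q z k)` at the nodes `z k` and `0`. -/
lemma one_sub_mul_sum_prod_weylFactor {ι : Type*} [Fintype ι] [DecidableEq ι] (q : ℂ) (z : ι → ℂ)
    (hz0 : ∀ i, z i ≠ 0) (hz : Function.Injective z) :
    (1 - q) * ∑ p, ∏ k, (if k = p then 1 else weylFactor q (z k) (z p)) =
      1 - q ^ Fintype.card ι := by
  set v : Option ι → ℂ := fun o => o.elim 0 z with hv
  have hvinj : Function.Injective v := by
    rintro (_ | a) (_ | b) hab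
    · rfl
    · exact absurd hab.symm (hz0 b)
    · exact absurd hab (hz0 a)
    · exact congrArg some (hz hab)
  set P : Polynomial ℂ := ∏ k, (Polynomial.X - Polynomial.C (q * z k)) with hP
  have hmonic : P.Monic := Polynomial.monic_prod_of_monic _ _ fun k _ => Polynomial.monic_X_sub_C _
  have hdeg : P.degree = Fintype.card ι := by
    rw [hP, Polynomial.degree_prod, sum_congr rfl fun k _ => Polynomial.degree_X_sub_C _]
    simp
  have key := Lagrange.leadingCoeff_eq_sum (s := univ) (v := v) hvinj.injOn (P := P)
    (by rw [hdeg]; simp)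
  have herase : ∀ i : Option ι, ∏ j ∈ univ.erase i, (v i - v j) =
      ∏ j, if j = i then 1 else (v i - v j) := by
    intro i
    rw [← Finset.mul_prod_erase univ _ (mem_univ i), if_pos rfl, one_mul]
    exact prod_congr rfl fun j hj => (if_neg (ne_of_mem_erase hj)).symm
  rw [hmonic.leadingCoeff, Fintype.sum_option] at key
  simp only [herase, Fintype.prod_option] at key
  have h0 : P.eval (v none) / ((if (none : Option ι) = none then 1 else v none - v none) *
      ∏ j : ι, if some j = (none : Option ι) then 1 else v none - v (some j)) =
      q ^ Fintype.card ι := by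
    simp only [hP, Polynomial.eval_prod, hv, if_true, one_mul, reduceCtorEq, if_false,
      Option.elim, ← Finset.prod_div_distrib]
    rw [← Finset.card_univ, ← Finset.prod_const]
    refine prod_congr rfl fun k _ => ?_
    have := hz0 k
    simp
    field_simp
  have h1 : ∀ p : ι, P.eval (v (some p)) /
      ((if (none : Option ι) = some p then 1 else v (some p) - v none) *
      ∏ j : ι, if some j = some p then 1 else v (some p) - v (some j)) =
      (1 - q) * ∏ k, (if k = p then 1 else weylFactor q (z k) (z p)) := by
    intro p
    have hp := hz0 p
    simp only [hP, Polynomial.eval_prod, hv, reduceCtorEq, if_false, Option.elim,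
      Option.some_inj, Polynomial.eval_sub, Polynomial.eval_X, Polynomial.eval_C, sub_zero]
    rw [mul_comm, ← div_div, ← Finset.prod_div_distrib,
      ← Finset.mul_prod_erase univ _ (mem_univ p),
      ← Finset.mul_prod_erase univ (fun k => if k = p then 1 else weylFactor q (z k) (z p))
        (mem_univ p)]
    have : ∀ k ∈ univ.erase p, (z p - q * z k) / (if k = p then 1 else z p - z k) =
        if k = p then 1 else weylFactor q (z k) (z p) := by
      intro k hk
      rw [if_neg (ne_of_mem_erase hk), if_neg (ne_of_mem_erase hk), weylFactor_eq _ _ hp]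
    rw [prod_congr rfl this]
    simp only [if_true]
    field_simp
  have key' := key.trans (congrArg₂ (· + ·) (Eq.trans (by simp) h0)
    (sum_congr rfl fun p _ => h1 p))
  rw [← mul_sum] at key'
  linear_combination -key'

lemma one_sub_pow_mul_sum_perm_fin (q : ℂ) (n : ℕ) (z : Fin n → ℂ)
    (hz0 : ∀ i, z i ≠ 0) (hz : Function.Injective z) :
    (1 - q) ^ n * ∑ w : Equiv.Perm (Fin n), weylProd q (z ∘ w) =
      ∏ i ∈ range n, (1 - q ^ (i + 1)) := by
  induction n with
  | zero => simp [weylProd]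
  | succ n ih =>
    have hfac : ∀ (p : Fin (n + 1)) (e : Equiv.Perm (Fin n)),
        weylProd q (z ∘ Equiv.Perm.decomposeFin.symm (p, e)) =
        (∏ k, (if k = p then 1 else weylFactor q (z k) (z p))) *
          weylProd q ((fun i : Fin n => z (Equiv.swap 0 p i.succ)) ∘ e) := by
      intro p e
      have hrow : ∏ k, (if k = p then 1 else weylFactor q (z k) (z p)) =
          ∏ i : Fin n, weylFactor q (z (Equiv.swap 0 p (e i).succ)) (z p) := by
        rw [Equiv.prod_comp e (fun i => weylFactor q (z (Equiv.swap 0 p i.succ)) (z p)),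
          ← Equiv.prod_comp (Equiv.swap 0 p), Fin.prod_univ_succ]
        simp only [Equiv.swap_apply_left, if_true, one_mul]
        refine prod_congr rfl fun i _ => if_neg fun h => ?_
        rw [Equiv.swap_apply_eq_iff, Equiv.swap_apply_right] at h
        exact Fin.succ_ne_zero i h
      rw [hrow]
      simp only [weylProd, Fin.prod_univ_succ, Function.comp_apply, Fin.not_lt_zero, if_false,
        prod_const_one, one_mul, Fin.succ_pos, if_true, Equiv.Perm.decomposeFin_symm_apply_zero,
        Equiv.Perm.decomposeFin_symm_apply_succ, Fin.succ_lt_succ_iff, prod_mul_distrib]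
    have hrest : ∀ p : Fin (n + 1), (1 - q) ^ n * ∑ e : Equiv.Perm (Fin n),
        weylProd q ((fun i : Fin n => z (Equiv.swap 0 p i.succ)) ∘ e) =
        ∏ i ∈ range n, (1 - q ^ (i + 1)) := fun p =>
      ih _ (fun i => hz0 _)
        (hz.comp ((Equiv.swap 0 p).injective.comp (Fin.succ_injective n)))
    have hone := one_sub_mul_sum_prod_weylFactor q z hz0 hz
    rw [Fintype.card_fin] at hone
    rw [← Equiv.sum_comp Equiv.Perm.decomposeFin.symm, Fintype.sum_prod_type, prod_range_succ,
      ← hone, mul_sum, mul_sum, mul_sum]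
    refine sum_congr rfl fun p _ => ?_
    rw [← hrest p, sum_congr rfl fun e _ => hfac p e, ← mul_sum]
    ring

/-- Macdonald's formula for the full flag variety. -/
lemma one_sub_pow_mul_sum_perm {ι : Type*} [Fintype ι] [LinearOrder ι] (q : ℂ) (z : ι → ℂ)
    (hz0 : ∀ i, z i ≠ 0) (hz : Function.Injective z) :
    (1 - q) ^ Fintype.card ι * ∑ w : Equiv.Perm ι, weylProd q (z ∘ w) =
      ∏ i ∈ range (Fintype.card ι), (1 - q ^ (i + 1)) := by
  let φ := Fintype.orderIsoFinOfCardEq ι rfl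
  rw [← one_sub_pow_mul_sum_perm_fin q _ (z ∘ φ) (fun i => hz0 _) (hz.comp φ.injective),
    ← Equiv.sum_comp φ.toEquiv.permCongr]
  congr 1
  refine sum_congr rfl fun w _ => ?_
  unfold weylProd
  rw [← Equiv.prod_comp φ.toEquiv]
  refine prod_congr rfl fun i _ => ?_
  rw [← Equiv.prod_comp φ.toEquiv]
  refine prod_congr rfl fun j _ => ?_
  simp [Equiv.permCongr_apply]

/-- The permutation of `ι` acting on each fiber of `h` by a given permutation. -/
def fiberPerm {ι κ : Type*} (h : ι → κ) (e : ∀ j, Equiv.Perm {i // h i = j}) : Equiv.Perm ι :=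
  (Equiv.sigmaFiberEquiv h).permCongr (Equiv.Perm.sigmaCongrRight e)

lemma fiberPerm_apply {ι κ : Type*} (h : ι → κ) (e : ∀ j, Equiv.Perm {i // h i = j}) (j : κ)
    (i : {i // h i = j}) : fiberPerm h e i = e j i := by
  obtain ⟨i, rfl⟩ := i
  rfl

lemma map_fiberPerm {ι κ : Type*} (h : ι → κ) (e : ∀ j, Equiv.Perm {i // h i = j}) (i : ι) :
    h (fiberPerm h e i) = h i := by
  rw [fiberPerm_apply h e (h i) ⟨i, rfl⟩]
  exact (e (h i) ⟨i, rfl⟩).2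

lemma prod_eq_prod_fibers {ι κ : Type*} [Fintype ι] [Fintype κ] [DecidableEq κ] (h : ι → κ)
    (f : ι → ℂ) : ∏ i, f i = ∏ j, ∏ i : {i // h i = j}, f i := by
  rw [← Equiv.prod_comp (Equiv.sigmaFiberEquiv h), Fintype.prod_sigma]
  rfl

/-- The product of the factors attached to the pairs lying in different blocks. -/
noncomputable def blockProd {ι κ : Type*} [Fintype ι] [LinearOrder κ] (h : ι → κ) (q : ℂ)
    (z : ι → ℂ) : ℂ :=
  ∏ i, ∏ j, if h j < h i then weylFactor q (z i) (z j) else 1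

lemma blockProd_comp_fiberPerm {ι κ : Type*} [Fintype ι] [LinearOrder κ] (h : ι → κ) (q : ℂ)
    (z : ι → ℂ) (e : ∀ j, Equiv.Perm {i // h i = j}) :
    blockProd h q (z ∘ fiberPerm h e) = blockProd h q z := by
  unfold blockProd
  rw [← Equiv.prod_comp (fiberPerm h e)
    (fun i => ∏ j, if h j < h i then weylFactor q (z i) (z j) else 1)]
  refine prod_congr rfl fun i _ => ?_
  rw [← Equiv.prod_comp (fiberPerm h e)
    (fun j => if h j < h (fiberPerm h e i) then weylFactor q (z (fiberPerm h e i)) (z j) else 1)]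
  simp only [map_fiberPerm, Function.comp_apply]

lemma weylProd_eq_blockProd_mul {ι κ : Type*} [Fintype ι] [LinearOrder ι] [Fintype κ]
    [LinearOrder κ] (h : ι → κ) (hmono : Monotone h) (q : ℂ) (z : ι → ℂ) :
    weylProd q z = blockProd h q z *
      ∏ j, weylProd q (fun i : {i // h i = j} => z i) := by
  have hfib : ∏ j, weylProd q (fun i : {i // h i = j} => z i) =
      ∏ i, ∏ k, if h k = h i ∧ k < i then weylFactor q (z i) (z k) else 1 := by
    rw [prod_eq_prod_fibers h]
    refine prod_congr rfl fun j _ => prod_congr rfl fun i _ => ?_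
    obtain ⟨i, rfl⟩ := i
    simp only [ite_and]
    rw [← prod_filter (fun k => h k = h i), prod_subtype (p := fun k => h k = h i) _ (by simp)]
    rfl
  rw [hfib]
  simp only [weylProd, blockProd, ← prod_mul_distrib]
  refine prod_congr rfl fun i _ => prod_congr rfl fun k _ => ?_
  rcases lt_trichotomy (h k) (h i) with hlt | heq | hgt
  · simp [hlt, hlt.ne, hmono.reflect_lt hlt]
  · simp [heq]
  · have : ¬ k < i := fun hk => (hmono hk.le).not_gt hgt
    simp [this, hgt.not_gt]

lemma sum_blockProd_mul {ι κ : Type*} [Fintype ι] [LinearOrder ι] [Fintype κ]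
    [LinearOrder κ] (h : ι → κ) (hmono : Monotone h) (q : ℂ) (z : ι → ℂ)
    (hz0 : ∀ i, z i ≠ 0) (hz : Function.Injective z) :
    (∑ w : Equiv.Perm ι, blockProd h q (z ∘ w)) *
        ∏ j, ∏ i ∈ range (Fintype.card {i // h i = j}), (1 - q ^ (i + 1)) =
      (∏ j, (Nat.factorial (Fintype.card {i // h i = j}) : ℂ)) *
        ∏ i ∈ range (Fintype.card ι), (1 - q ^ (i + 1)) := by
  have hcard : Fintype.card ι = ∑ j, Fintype.card {i // h i = j} := by
    rw [← Fintype.card_sigma]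
    exact Fintype.card_congr (Equiv.sigmaFiberEquiv h).symm
  have hterm : ∀ w : Equiv.Perm ι, blockProd h q (z ∘ w) *
      ∏ j, ∏ i ∈ range (Fintype.card {i // h i = j}), (1 - q ^ (i + 1)) =
      (1 - q) ^ Fintype.card ι * ∑ e : ∀ j, Equiv.Perm {i // h i = j},
        weylProd q (z ∘ (w * fiberPerm h e : Equiv.Perm ι)) := by
    intro w
    have hblock : ∀ j, ∏ i ∈ range (Fintype.card {i // h i = j}), (1 - q ^ (i + 1)) =
        (1 - q) ^ Fintype.card {i // h i = j} * ∑ e : Equiv.Perm {i // h i = j},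
          weylProd q ((fun i : {i // h i = j} => z (w i)) ∘ e) := fun j =>
      (one_sub_pow_mul_sum_perm q _ (fun i => hz0 _)
        (hz.comp (w.injective.comp Subtype.val_injective))).symm
    rw [prod_congr rfl fun j _ => hblock j, prod_mul_distrib, prod_pow_eq_pow_sum, ← hcard,
      Fintype.prod_sum, mul_left_comm, mul_sum]
    congr 1
    refine sum_congr rfl fun e _ => ?_
    rw [weylProd_eq_blockProd_mul h hmono, Equiv.Perm.coe_mul, ← Function.comp_assoc,
      blockProd_comp_fiberPerm]
    congr 1
    refine prod_congr rfl fun j _ => ?_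
    congr 1
    funext i
    simp [fiberPerm_apply]
  rw [sum_mul, sum_congr rfl fun w _ => hterm w, ← mul_sum, sum_comm]
  have hshift : ∀ e : ∀ j, Equiv.Perm {i // h i = j},
      ∑ w : Equiv.Perm ι, weylProd q (z ∘ (w * fiberPerm h e : Equiv.Perm ι)) =
      ∑ w : Equiv.Perm ι, weylProd q (z ∘ w) := fun e =>
    Equiv.sum_comp (Equiv.mulRight (fiberPerm h e)) (fun w => weylProd q (z ∘ w))
  rw [sum_congr rfl fun e _ => hshift e, sum_const, nsmul_eq_mul, card_univ, Fintype.card_pi,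
    mul_left_comm, one_sub_pow_mul_sum_perm q z hz0 hz]
  simp [Fintype.card_perm]

/-- Let `(l_1, …, l_p)` be a composition of `N ≥ 1` with block function `h` (so that
`h i = j` iff `l_1 + ⋯ + l_{j-1} ≤ i < l_1 + ⋯ + l_j`, indices zero-based), let `q ∈ ℂ`
and let `z_1, …, z_N` be nonzero pairwise distinct complex numbers.  Then
`(Σ_{w ∈ S_N} Π_{h(i)>h(j)} (1 - q z_{w(i)}/z_{w(j)})/(1 - z_{w(i)}/z_{w(j)}))
   · Π_j Π_{i=1}^{l_j} (1 - q^i) = (Π_j l_j!) · Π_{i=1}^{N} (1 - q^i)`.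
In particular, the sum is independent of the `z_i` and equals the Poincaré polynomial
of the cotangent bundle of the partial flag variety times `|W̃| = Π_j l_j!`. -/
theorem weyl_sum_partial_flag (N p : ℕ) (hN : 1 ≤ N) (l : Fin p → ℕ)
    (hl : ∀ j, 0 < l j) (hsum : ∑ j, l j = N) (h : Fin N → Fin p)
    (hh : ∀ (i : Fin N) (j : Fin p), h i = j ↔
      (∑ j' ∈ Finset.univ.filter (fun j' => j' < j), l j') ≤ (i : ℕ) ∧
        (i : ℕ) < ∑ j' ∈ Finset.univ.filter (fun j' => j' ≤ j), l j')
    (q : ℂ) (z : Fin N → ℂ) (hz0 : ∀ i, z i ≠ 0) (hz : Function.Injective z) :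
    (∑ w : Equiv.Perm (Fin N),
        ∏ ij ∈ Finset.univ.filter (fun ij : Fin N × Fin N => h ij.2 < h ij.1),
          (1 - q * z (w ij.1) / z (w ij.2)) / (1 - z (w ij.1) / z (w ij.2))) *
      ∏ j : Fin p, ∏ i ∈ Finset.range (l j), (1 - q ^ (i + 1)) =
      ((∏ j : Fin p, Nat.factorial (l j) : ℕ) : ℂ) *
        ∏ i ∈ Finset.range N, (1 - q ^ (i + 1)) := by
  have hmono : Monotone h := by
    intro a b hab
    by_contra! hlt
    have h1 := ((hh a _).1 rfl).1
    have h2 := ((hh b _).1 rfl).2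
    have h3 : ∑ j' ∈ univ.filter (fun j' => j' ≤ h b), l j' ≤
        ∑ j' ∈ univ.filter (fun j' => j' < h a), l j' :=
      sum_le_sum_of_subset fun j => by
        simpa using fun hj : j ≤ h b => hj.trans_lt hlt
    have h4 : (a : ℕ) ≤ b := hab
    omega
  have hcard : ∀ j, Fintype.card {i // h i = j} = l j := by
    intro j
    have hle : ∑ j' ∈ univ.filter (fun j' => j' ≤ j), l j' ≤ N :=
      hsum ▸ sum_le_sum_of_subset (filter_subset _ _)
    have hsplit : ∑ j' ∈ univ.filter (fun j' => j' ≤ j), l j' =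
        l j + ∑ j' ∈ univ.filter (fun j' => j' < j), l j' := by
      rw [← sum_insert (by simp)]
      refine sum_congr ?_ fun _ _ => rfl
      ext k
      simp [le_iff_eq_or_lt]
    rw [Fintype.card_subtype, ← card_map Fin.valEmbedding]
    have himg : (univ.filter fun i => h i = j).map Fin.valEmbedding =
        Ico (∑ j' ∈ univ.filter (fun j' => j' < j), l j')
          (∑ j' ∈ univ.filter (fun j' => j' ≤ j), l j') := by
      ext m
      simp only [mem_map, mem_filter, mem_univ, true_and, hh, Fin.valEmbedding_apply, mem_Ico]
      constructor
      · rintro ⟨i, hi, rfl⟩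
        exact hi
      · intro hm
        exact ⟨⟨m, hm.2.trans_le hle⟩, hm, rfl⟩
    rw [himg, Nat.card_Ico, hsplit, Nat.add_sub_cancel]
  have key := sum_blockProd_mul h hmono q z hz0 hz
  simp only [hcard, Fintype.card_fin] at key
  rw [Nat.cast_prod, ← key]
  congr 1
  refine sum_congr rfl fun w _ => ?_
  rw [prod_filter, Fintype.prod_prod_type]
  rfl
end

section
/- Let N ≥ 1, let q ∈ ℂ, and let z_1, …, z_N ∈ ℂ be nonzero and pairwise distinct. Then (Σ_{w ∈ S_N} Π_{1 ≤ i < j ≤ N} (1 − q·z_{w(i)}/z_{w(j)}) / (1 − z_{w(i)}/z_{w(j)})) · (1 − q)^N = Π_{i=1}^{N} (1 − q^i). In particular, the left-hand sum is independent of the z_i and equals the q-factorial [N]_q! = Π_{i=1}^{N} (1 − q^i)/(1 − q), the Poincaré polynomial of the cotangent bundle of the complete flag variety of ℂ^N. -/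
open Finset

section

variable {F : Type*} [Field F]

open Polynomial in
/-- The symmetrization identity behind the recursion `[n]_q! = [n]_q · [n - 1]_q!`: the leading
coefficient of `∏ j, (z j - q X)`, interpolated at `0` and at the points `z i`. -/
theorem sum_prod_erase_sub_mul_div_sub {ι : Type*} [Fintype ι] [DecidableEq ι] (q : F) (z : ι → F)
    (hz0 : ∀ i, z i ≠ 0) (hz : Function.Injective z) :
    (∑ i, ∏ j ∈ univ.erase i, (z j - q * z i) / (z j - z i)) * (1 - q) =
      1 - q ^ Fintype.card ι := by
  let v : Option ι → F := fun o => o.elim 0 z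
  have hv : Function.Injective v := by
    rintro (_ | i) (_ | j) h
    · rfl
    · exact absurd h.symm (hz0 j)
    · exact absurd h (hz0 i)
    · exact congrArg some (hz h)
  let P : F[X] := ∏ j : ι, (C (z j) - C q * X)
  have hlin (j : ι) : (C (z j) - C q * X).natDegree ≤ 1 := by compute_degree
  have hcoeff : P.coeff (Fintype.card ι) = (-q) ^ Fintype.card ι := by
    have h := coeff_prod_of_natDegree_le (s := univ) (fun j : ι => C (z j) - C q * X) 1
      fun j _ => hlin j
    simpa using h
  have hdeg : P.degree < #(univ : Finset (Option ι)) := by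
    have h : P.natDegree ≤ Fintype.card ι :=
      (natDegree_prod_le _ _).trans <| (sum_le_card_nsmul _ _ 1 fun j _ => hlin j).trans (by simp)
    refine (degree_le_of_natDegree_le h).trans_lt ?_
    rw [card_univ, Fintype.card_option]
    exact_mod_cast Nat.lt_succ_self _
  have key := Lagrange.coeff_eq_sum (s := univ) (v := v) hv.injOn hdeg
  rw [card_univ, Fintype.card_option, Nat.add_sub_cancel, hcoeff, Fintype.sum_option] at key
  have hnone : P.eval (v none) / ∏ o ∈ univ.erase none, (v none - v o) =
      (-1) ^ Fintype.card ι := by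
    have h : ∏ o ∈ univ.erase none, (v none - v o) = (-1) ^ Fintype.card ι * ∏ j, z j := by
      rw [← filter_ne', prod_filter, Fintype.prod_option]
      simp [v, prod_neg]
    have hprod : ∏ j, z j ≠ 0 := prod_ne_zero_iff.2 fun j _ => hz0 j
    rw [h]
    simp only [P, v, eval_prod]
    simp only [Option.elim_none, eval_sub, eval_mul, eval_C, eval_X, mul_zero, sub_zero]
    rw [div_mul_cancel_right₀ hprod, ← inv_pow, inv_neg_one]
  have hsome (i : ι) : P.eval (v (some i)) / ∏ o ∈ univ.erase (some i), (v (some i) - v o) =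
      -(-1) ^ Fintype.card ι *
        ((∏ j ∈ univ.erase i, (z j - q * z i) / (z j - z i)) * (1 - q)) := by
    have hden : ∏ o ∈ univ.erase (some i), (v (some i) - v o) =
        z i * ∏ j ∈ univ.erase i, (z i - z j) := by
      rw [← filter_ne', ← filter_ne', prod_filter, prod_filter, Fintype.prod_option]
      simp [v]
    have hnum : P.eval (v (some i)) = (z i - q * z i) * ∏ j ∈ univ.erase i, (z j - q * z i) := by
      rw [mul_prod_erase univ (fun j => z j - q * z i) (mem_univ i)]
      simp [P, v, eval_prod]
    have hsign : ∏ j ∈ univ.erase i, (z i - z j) =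
        -(-1) ^ Fintype.card ι * ∏ j ∈ univ.erase i, (z j - z i) := by
      have hcard : #(univ.erase i) + 1 = Fintype.card ι := by
        rw [card_erase_add_one (mem_univ i), card_univ]
      rw [← hcard, pow_succ, mul_neg_one, neg_neg, ← prod_neg]
      simp
    have hne : ∏ j ∈ univ.erase i, (z j - z i) ≠ 0 :=
      prod_ne_zero_iff.2 fun j hj => sub_ne_zero.2 fun h => ne_of_mem_erase hj (hz h)
    have hsq : ((-1 : F) ^ Fintype.card ι) * (-1) ^ Fintype.card ι = 1 := by
      rw [← mul_pow]; simp
    have hpow : (-1 : F) ^ Fintype.card ι ≠ 0 := left_ne_zero_of_mul_eq_one hsq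
    have hi := hz0 i
    rw [hden, hnum, hsign, prod_div_distrib]
    generalize ∏ j ∈ univ.erase i, (z j - q * z i) = A
    field_simp
    linear_combination ((1 - q) * A) * hsq
  rw [hnone, sum_congr rfl fun i _ => hsome i, ← mul_sum, ← sum_mul, neg_pow q] at key
  have hpow : (-1 : F) ^ Fintype.card ι ≠ 0 := pow_ne_zero _ (neg_ne_zero.2 one_ne_zero)
  refine mul_left_cancel₀ hpow ?_
  linear_combination key

/-- The product over `j ≠ p` enumerated by the transposition of `0` and `p`. -/
theorem prod_swap_zero_succ {M : Type*} [CommMonoid M] {n : ℕ} (p : Fin (n + 1))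
    (g : Fin (n + 1) → M) :
    ∏ j : Fin n, g (Equiv.swap 0 p j.succ) = ∏ j ∈ univ.erase p, g j := by
  rw [← filter_ne', prod_filter, ← Equiv.prod_comp (Equiv.swap 0 p), Fin.prod_univ_succ]
  simp only [Equiv.swap_apply_left, ne_eq, not_true_eq_false, if_false, one_mul]
  refine prod_congr rfl fun j _ => (if_pos fun h => Fin.succ_ne_zero j ?_).symm
  exact (Equiv.swap 0 p).injective (h.trans (Equiv.swap_apply_left 0 p).symm)

theorem prod_filter_lt_fin_succ {M : Type*} [CommMonoid M] {n : ℕ}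
    (f : Fin (n + 1) → Fin (n + 1) → M) :
    ∏ ij ∈ univ.filter (fun ij : Fin (n + 1) × Fin (n + 1) => ij.1 < ij.2), f ij.1 ij.2 =
      (∏ j : Fin n, f 0 j.succ) *
        ∏ ij ∈ univ.filter (fun ij : Fin n × Fin n => ij.1 < ij.2), f ij.1.succ ij.2.succ := by
  simp only [prod_filter, Fintype.prod_prod_type, Fin.prod_univ_succ]
  simp

theorem sum_perm_prod_lt_mul_one_sub_pow (q : F) (n : ℕ) (z : Fin n → F)
    (hz0 : ∀ i, z i ≠ 0) (hz : Function.Injective z) :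
    (∑ w : Equiv.Perm (Fin n),
        ∏ ij ∈ univ.filter (fun ij : Fin n × Fin n => ij.1 < ij.2),
          (1 - q * z (w ij.1) / z (w ij.2)) / (1 - z (w ij.1) / z (w ij.2))) *
      (1 - q) ^ n = ∏ i ∈ range n, (1 - q ^ (i + 1)) := by
  induction n with
  | zero => simp
  | succ n ih =>
    have hfactor (i j : Fin (n + 1)) :
        (1 - q * z i / z j) / (1 - z i / z j) = (z j - q * z i) / (z j - z i) := by
      rw [one_sub_div (hz0 j), one_sub_div (hz0 j), div_div_div_cancel_right₀ (hz0 j)]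
    have hrec (p : Fin (n + 1)) := ih (fun j => z (Equiv.swap 0 p j.succ)) (fun _ => hz0 _)
      (hz.comp ((Equiv.swap 0 p).injective.comp (Fin.succ_injective n)))
    have hsum := sum_prod_erase_sub_mul_div_sub q z hz0 hz
    rw [Fintype.card_fin] at hsum
    rw [← Equiv.sum_comp Equiv.Perm.decomposeFin.symm, Fintype.sum_prod_type, prod_range_succ,
      ← hsum, sum_mul, sum_mul, mul_sum]
    refine sum_congr rfl fun p _ => ?_
    rw [← hrec p, ← prod_swap_zero_succ p fun j => (z j - q * z p) / (z j - z p)]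
    have hsplit (e : Equiv.Perm (Fin n)) := prod_filter_lt_fin_succ fun i j =>
      (1 - q * z (Equiv.Perm.decomposeFin.symm (p, e) i) /
        z (Equiv.Perm.decomposeFin.symm (p, e) j)) /
      (1 - z (Equiv.Perm.decomposeFin.symm (p, e) i) /
        z (Equiv.Perm.decomposeFin.symm (p, e) j))
    have hperm (e : Equiv.Perm (Fin n)) :=
      Equiv.prod_comp e fun j : Fin n =>
        (z (Equiv.swap 0 p j.succ) - q * z p) / (z (Equiv.swap 0 p j.succ) - z p)
    rw [sum_congr rfl fun e _ => hsplit e]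
    simp only [Equiv.Perm.decomposeFin_symm_apply_zero,
      Equiv.Perm.decomposeFin_symm_apply_succ, hfactor, hperm, ← mul_sum]
    ring

end

/-- Let `N ≥ 1`, `q ∈ ℂ`, and let `z_1, …, z_N` be nonzero pairwise distinct complex
numbers.  Then
`(Σ_{w ∈ S_N} Π_{i<j} (1 - q z_{w(i)}/z_{w(j)})/(1 - z_{w(i)}/z_{w(j)})) · (1-q)^N
  = Π_{i=1}^{N} (1 - q^i)`.
In particular the left-hand sum is independent of the `z_i` and equals the `q`-factorial,
the Poincaré polynomial of the cotangent bundle of the complete flag variety of `ℂ^N`. -/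
theorem weyl_sum_complete_flag (N : ℕ) (hN : 1 ≤ N) (q : ℂ) (z : Fin N → ℂ)
    (hz0 : ∀ i, z i ≠ 0) (hz : Function.Injective z) :
    (∑ w : Equiv.Perm (Fin N),
        ∏ ij ∈ Finset.univ.filter (fun ij : Fin N × Fin N => ij.1 < ij.2),
          (1 - q * z (w ij.1) / z (w ij.2)) / (1 - z (w ij.1) / z (w ij.2))) *
      (1 - q) ^ N = ∏ i ∈ Finset.range N, (1 - q ^ (i + 1)) := by
  exact sum_perm_prod_lt_mul_one_sub_pow q N z hz0 hz
end
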